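/- Let k ≥ 0, ℓ ≥ 1, λ ∈ P_ℓ^k and z an integer with 1 ≤ z ≤ bot_λ − 1 and λ_z > λ_{z+1}. Let c′ ≥ 1 be the least integer with down_λ^{c′}(z) ∈ [bot_λ + 1, ℓ]. Then for every integer a with 1 ≤ a ≤ c′ there exists a finitely supported family of integers (b_μ) indexed by μ ∈ P_ℓ^k, with b_μ = 0 unless μ_x = λ_x for all x ∈ [1, z], such that K(Δ^k(λ); M_z(λ); λ − ε_{down_λ^a(z)}) = ∑_{μ ∈ P_ℓ^k} b_μ · ĝ_μ^{(z)} and (−1)^{|λ|−|μ|−1} · b_μ ≥ 0 for every μ. -/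

import Mathlib

open scoped Classical

noncomputable section

/-- The ambient ring: formal power series over ℚ in countably many variables. -/
abbrev R : Type := MvPowerSeries ℕ ℚ

/-- The complete homogeneous symmetric function `h_m` (equal to `0` for `m < 0`):
its coefficient at a monomial is `1` if the monomial has total degree `m`, else `0`. -/
def hh (m : ℤ) : R := fun d => if ((d.sum fun _ e => (e : ℤ)) = m) then 1 else 0

/-- The inhomogeneous analogue `k_m^{(r)} = ∑_{i=0}^{m} C(r+i−1, i) · h_{m−i}`. -/
def kk (r : ℕ) (m : ℤ) : R :=
  ∑ i ∈ Finset.range (m.toNat + 1), ((r + i - 1).choose i : ℚ) • hh (m - (i : ℤ))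

/-- The dual stable Grothendieck polynomial `g_γ`, as an `ℓ × ℓ` determinant with
`(i,j)` entry `k_{γ_i + j − i}^{(i−1)}` (indices 1-based). -/
def gg (ℓ : ℕ) (γ : ℕ → ℤ) : R :=
  (Matrix.of fun i j : Fin ℓ =>
    kk i.val (γ (i.val + 1) + (j.val : ℤ) - (i.val : ℤ))).det

/-- The `i`-th standard basis vector `ε_i`. -/
def eps (i : ℕ) : ℕ → ℤ := fun x => if x = i then 1 else 0

/-- The Katalan function `K(Ψ; M; γ)`. -/
def katalan (ℓ : ℕ) (Ψ : Finset (ℕ × ℕ)) (M : Multiset ℕ) (γ : ℕ → ℤ) : R :=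
  (M.powerset.map fun S =>
    (-1 : R) ^ Multiset.card S *
      ∑ᶠ α : {p // p ∈ Ψ} → ℕ,
        gg ℓ (fun x =>
          γ x + (∑ p ∈ Ψ.attach, (α p : ℤ) * (eps p.1.1 x - eps p.1.2 x))
            - (S.map fun z => eps z x).sum)).sum

/-- The set of positive roots `Δ_ℓ^+ = {(i,j) : 1 ≤ i < j ≤ ℓ}`. -/
def DeltaPlus (ℓ : ℕ) : Finset (ℕ × ℕ) :=
  (Finset.Icc 1 ℓ ×ˢ Finset.Icc 1 ℓ).filter fun p => p.1 < p.2

/-- A root ideal: an upper order ideal of `Δ_ℓ^+`. -/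
def IsRootIdeal (ℓ : ℕ) (Ψ : Finset (ℕ × ℕ)) : Prop :=
  Ψ ⊆ DeltaPlus ℓ ∧
    ∀ a b c d : ℕ, (a, b) ∈ Ψ → (c, d) ∈ DeltaPlus ℓ → c ≤ a → b ≤ d → (c, d) ∈ Ψ

/-- The root ideal `Δ^k(λ) = {(i,j) ∈ Δ_ℓ^+ : j > k − λ_i + i}`. -/
def DeltaK (k ℓ : ℕ) (lam : ℕ → ℤ) : Finset (ℕ × ℕ) :=
  (DeltaPlus ℓ).filter fun p => (k : ℤ) - lam p.1 + (p.1 : ℤ) < (p.2 : ℤ)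

/-- `bot(Ψ)`: the largest `x` such that row `x` of `Ψ` is nonempty (`0` if `Ψ = ∅`). -/
def botIdeal (Ψ : Finset (ℕ × ℕ)) : ℕ := Ψ.sup Prod.fst

/-- `bot_λ := bot(Δ^k(λ))`. -/
def botL (k ℓ : ℕ) (lam : ℕ → ℤ) : ℕ := botIdeal (DeltaK k ℓ lam)

/-- A removable root of a root ideal. -/
def IsRemovable (ℓ : ℕ) (Ψ : Finset (ℕ × ℕ)) (α : ℕ × ℕ) : Prop :=
  α ∈ Ψ ∧ IsRootIdeal ℓ (Ψ.erase α)

/-- `down_Ψ(x)` is defined, i.e. row `x` of `Ψ` contains a removable root. -/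
def HasDown (ℓ : ℕ) (Ψ : Finset (ℕ × ℕ)) (x : ℕ) : Prop :=
  ∃ j, IsRemovable ℓ Ψ (x, j)

/-- `down_Ψ(x)`: the column of the removable root in row `x` (junk value `0` if
row `x` has no removable root). -/
def down (ℓ : ℕ) (Ψ : Finset (ℕ × ℕ)) (x : ℕ) : ℕ :=
  ((Ψ.filter fun p => p.1 = x ∧ IsRemovable ℓ Ψ p).image Prod.snd).sup id

/-- `down_λ := down_{Δ^k(λ)}`. -/
def downL (k ℓ : ℕ) (lam : ℕ → ℤ) : ℕ → ℕ := down ℓ (DeltaK k ℓ lam)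

/-- The `a`-fold iterate `down_Ψ^a(x)` is defined. -/
def DownIterDefined (ℓ : ℕ) (Ψ : Finset (ℕ × ℕ)) (a x : ℕ) : Prop :=
  ∀ b < a, HasDown ℓ Ψ ((down ℓ Ψ)^[b] x)

/-- `L(ℛ)`: the multiset of second components of `ℛ`, with multiplicity. -/
def Lmul (ℛ : Finset (ℕ × ℕ)) : Multiset ℕ := ℛ.val.map Prod.snd

/-- `λ ∈ P_ℓ^k`: a `k`-bounded partition with `ℓ` parts allowed to be zero. -/
def IsKBounded (k ℓ : ℕ) (lam : ℕ → ℤ) : Prop :=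
  lam 1 ≤ (k : ℤ) ∧ (∀ i, 1 ≤ i → i < ℓ → lam (i + 1) ≤ lam i) ∧ 0 ≤ lam ℓ

/-- The multiset `M_z(λ)`: `L(Δ^k(λ))` with one occurrence of `down_λ(x)` removed
for each `x ∈ [z, bot_λ]`. -/
def Mz (k ℓ : ℕ) (lam : ℕ → ℤ) (z : ℕ) : Multiset ℕ :=
  Lmul (DeltaK k ℓ lam) - ((Finset.Icc z (botL k ℓ lam)).val.map (downL k ℓ lam))

/-- The `K`-`k`-Schur function of weight `z`: `ĝ_λ^{(z)} = K(Δ^k(λ); M_z(λ); λ)`. -/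
def wkschur (k ℓ : ℕ) (lam : ℕ → ℤ) (z : ℕ) : R :=
  katalan ℓ (DeltaK k ℓ lam) (Mz k ℓ lam z) lam

/-- The `K`-`k`-Schur function `g_λ^{(k)} = K(Δ^k(λ); L(Δ^{k+1}(λ)); λ)`. -/
def kkschur (k ℓ : ℕ) (lam : ℕ → ℤ) : R :=
  katalan ℓ (DeltaK k ℓ lam) (Lmul (DeltaK (k + 1) ℓ lam)) lam

/-- The closed `k`-Schur Katalan function `𝔤_λ^{(k)} = K(Δ^k(λ); L(Δ^k(λ)); λ)`. -/
def closedkschur (k ℓ : ℕ) (lam : ℕ → ℤ) : R :=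
  katalan ℓ (DeltaK k ℓ lam) (Lmul (DeltaK k ℓ lam)) lam

/-- `|λ| = λ_1 + ⋯ + λ_ℓ`. -/
def psize (ℓ : ℕ) (lam : ℕ → ℤ) : ℤ := ∑ i ∈ Finset.Icc 1 ℓ, lam i

/-! ### Vanishing and straightening of `gg` -/

lemma kk_of_neg (r : ℕ) {m : ℤ} (hm : m < 0) : kk r m = 0 := by
  have h0 : m.toNat = 0 := Int.toNat_of_nonpos hm.le
  have hh0 : hh m = 0 := by
    funext d
    have : (0 : ℤ) ≤ d.sum fun _ e => (e : ℤ) := Finset.sum_nonneg fun _ _ => by positivity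
    simp only [hh]
    rw [if_neg (by omega)]
    rfl
  simp [kk, h0, hh0]

lemma kk_succ_sub (r : ℕ) (m : ℤ) : kk (r + 1) m = kk r m + kk (r + 1) (m - 1) := by
  rcases lt_or_ge m 0 with hm | hm
  · simp [kk_of_neg _ hm, kk_of_neg _ (show m - 1 < 0 by omega)]
  obtain ⟨n, rfl⟩ := Int.eq_ofNat_of_zero_le hm
  rcases n with _ | n
  · rw [kk_of_neg (r + 1) (show ((0 : ℕ) : ℤ) - 1 < 0 by norm_num)]
    simp [kk]
  have h1 : ((n + 1 : ℕ) : ℤ).toNat + 1 = (n + 1) + 1 := by omega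
  have h2 : (((n + 1 : ℕ) : ℤ) - 1).toNat + 1 = n + 1 := by omega
  unfold kk
  rw [h1, h2, Finset.sum_range_succ' _ (n + 1), Finset.sum_range_succ' _ (n + 1),
    add_right_comm (Finset.sum _ _), ← Finset.sum_add_distrib]
  congr 1
  · refine Finset.sum_congr rfl fun i _ => ?_
    have e1 : r + 1 + (i + 1) - 1 = (r + i) + 1 := by omega
    have e2 : r + (i + 1) - 1 = r + i := by omega
    have e3 : r + 1 + i - 1 = r + i := by omega
    have e4 : ((n + 1 : ℕ) : ℤ) - 1 - (i : ℤ) = ((n + 1 : ℕ) : ℤ) - ((i + 1 : ℕ) : ℤ) := by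
      push_cast; ring
    rw [e1, e2, e3, e4, Nat.choose_succ_succ, ← add_smul]
    congr 1
    push_cast; ring
  · simp

lemma sum_perm_upper_le {n : ℕ} (w : Equiv.Perm (Fin n)) (t : ℕ) :
    ∑ i : Fin n with t ≤ i.val, ((w i).val : ℤ) ≤ ∑ i : Fin n with t ≤ i.val, (i.val : ℤ) := by
  have key : ∑ i : Fin n with t ≤ i.val, (((w i).val : ℤ) - t)
      ≤ ∑ i : Fin n with t ≤ i.val, ((i.val : ℤ) - t) := by
    calc ∑ i : Fin n with t ≤ i.val, (((w i).val : ℤ) - t)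
        ≤ ∑ i : Fin n with t ≤ i.val, max (((w i).val : ℤ) - t) 0 :=
          Finset.sum_le_sum fun i _ => le_max_left _ _
      _ ≤ ∑ i : Fin n, max (((w i).val : ℤ) - t) 0 :=
          Finset.sum_le_sum_of_subset_of_nonneg (Finset.filter_subset _ _)
            fun i _ _ => le_max_right _ _
      _ = ∑ i : Fin n, max ((i.val : ℤ) - t) 0 :=
          Equiv.sum_comp w fun i : Fin n => max ((i.val : ℤ) - t) 0
      _ = ∑ i : Fin n with t ≤ i.val, ((i.val : ℤ) - t) := by
          rw [Finset.sum_filter]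
          refine Finset.sum_congr rfl fun i _ => ?_
          split_ifs with h
          · exact max_eq_left (by omega)
          · exact max_eq_right (by omega)
  simpa [Finset.sum_sub_distrib] using key

lemma sum_Icc_eq_sum_fin (ℓ t : ℕ) (γ : ℕ → ℤ) :
    ∑ x ∈ Finset.Icc (t + 1) ℓ, γ x = ∑ i : Fin ℓ with t ≤ i.val, γ (i.val + 1) := by
  symm
  refine Finset.sum_bij (fun i _ => i.val + 1) ?_ ?_ ?_ ?_
  · intro i hi
    simp only [Finset.mem_filter, Finset.mem_univ, true_and] at hi
    simp only [Finset.mem_Icc]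
    omega
  · intro i _ j _ h
    exact Fin.ext (by simpa using h)
  · intro x hx
    simp only [Finset.mem_Icc] at hx
    exact ⟨⟨x - 1, by omega⟩, by simp; omega, by simp; omega⟩
  · intros; rfl

/-- `g_γ` vanishes as soon as some tail sum of `γ` is negative. -/
lemma gg_eq_zero_of_tail_neg {ℓ j : ℕ} (hj : 1 ≤ j) {γ : ℕ → ℤ}
    (h : ∑ x ∈ Finset.Icc j ℓ, γ x < 0) : gg ℓ γ = 0 := by
  obtain ⟨t, rfl⟩ : ∃ t, j = t + 1 := ⟨j - 1, by omega⟩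
  rw [sum_Icc_eq_sum_fin] at h
  unfold gg
  rw [← Matrix.det_transpose, Matrix.det_apply]
  refine Finset.sum_eq_zero fun w _ => ?_
  obtain ⟨i, hi⟩ : ∃ i : Fin ℓ, γ (i.val + 1) + ((w i).val : ℤ) - (i.val : ℤ) < 0 := by
    by_contra! hc
    have h1 : 0 ≤ ∑ i : Fin ℓ with t ≤ i.val, (γ (i.val + 1) + ((w i).val : ℤ) - (i.val : ℤ)) :=
      Finset.sum_nonneg fun i _ => hc i
    rw [Finset.sum_sub_distrib, Finset.sum_add_distrib] at h1
    have h2 := sum_perm_upper_le w t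
    omega
  rw [Finset.prod_eq_zero (Finset.mem_univ i), smul_zero]
  simp [kk_of_neg _ hi]

/-- The determinant `(1 - L_{y+1}) g_γ` with `y = t + 1`: rows `y` and `y + 1` carry the same
superscript. -/
def ggLower (ℓ t : ℕ) (γ : ℕ → ℤ) : R :=
  gg ℓ γ - gg ℓ (γ - eps (t + 2))

lemma ggLower_eq_det {ℓ t : ℕ} (ht : t + 1 < ℓ) (γ : ℕ → ℤ) :
    ggLower ℓ t γ = (Matrix.of fun i j : Fin ℓ =>
      kk (if i.val = t + 1 then t else i.val) (γ (i.val + 1) + (j.val : ℤ) - (i.val : ℤ))).det := by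
  set Y : Fin ℓ := ⟨t + 1, ht⟩ with hY
  set A : Matrix (Fin ℓ) (Fin ℓ) R := Matrix.of fun i j : Fin ℓ =>
    kk i.val (γ (i.val + 1) + (j.val : ℤ) - (i.val : ℤ)) with hA
  have e0 : gg ℓ γ = (A.updateRow Y ((fun j : Fin ℓ => kk t (γ (t + 2) + (j.val : ℤ) - (t + 1 : ℕ)))
      + fun j : Fin ℓ => kk (t + 1) (γ (t + 2) + (j.val : ℤ) - (t + 1 : ℕ) - 1))).det := by
    unfold gg
    congr 1
    ext1 i j
    by_cases hi : i = Y
    · subst hi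
      rw [Matrix.updateRow_self]
      exact kk_succ_sub t _
    · rw [Matrix.updateRow_ne hi]
  have e1 : gg ℓ (γ - eps (t + 2)) = (A.updateRow Y
      (fun j : Fin ℓ => kk (t + 1) (γ (t + 2) + (j.val : ℤ) - (t + 1 : ℕ) - 1))).det := by
    unfold gg
    congr 1
    ext1 i j
    by_cases hi : i = Y
    · subst hi
      rw [Matrix.updateRow_self]
      simp only [hY, Matrix.of_apply, Pi.sub_apply, eps, if_true]
      congr 1
      ring
    · rw [Matrix.updateRow_ne hi]
      have : ¬ (i.val = t + 1) := fun h => hi (Fin.ext (by simp [hY]; omega))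
      simp [hA, eps, this]
  rw [ggLower, e0, e1, Matrix.det_updateRow_add, add_sub_cancel_right]
  congr 1
  ext1 i j
  by_cases hi : i = Y
  · subst hi
    simp [hY, Matrix.updateRow_self]
  · rw [Matrix.updateRow_ne hi]
    have : ¬ (i.val = t + 1) := fun h => hi (Fin.ext (by simp [hY]; omega))
    simp [hA, this]

lemma ggLower_swap {ℓ t : ℕ} (ht : t + 1 < ℓ) (γ : ℕ → ℤ) :
    ggLower ℓ t (γ ∘ Equiv.swap (t + 1) (t + 2) + (eps (t + 2) - eps (t + 1)))
      = - ggLower ℓ t γ := by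
  set X : Fin ℓ := ⟨t, by omega⟩ with hX
  set Y : Fin ℓ := ⟨t + 1, ht⟩ with hY
  have hXY : X ≠ Y := by simp [hX, hY]
  rw [ggLower_eq_det ht, ggLower_eq_det ht]
  have := Matrix.det_permute (Equiv.swap X Y) (Matrix.of fun i j : Fin ℓ =>
      kk (if i.val = t + 1 then t else i.val) (γ (i.val + 1) + (j.val : ℤ) - (i.val : ℤ)))
  rw [Equiv.Perm.sign_swap hXY] at this
  simp only [Units.val_neg, Units.val_one, Int.cast_neg, Int.cast_one, neg_mul, one_mul] at this
  rw [← this]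
  congr 1
  ext1 i j
  simp only [Matrix.of_apply, Matrix.submatrix_apply, id]
  by_cases hiX : i = X
  · subst hiX
    rw [Equiv.swap_apply_left]
    simp [hX, hY, eps]
    congr 1
    ring
  by_cases hiY : i = Y
  · subst hiY
    rw [Equiv.swap_apply_right]
    simp [hX, hY, eps]
    congr 1
    ring
  · rw [Equiv.swap_apply_of_ne_of_ne hiX hiY]
    have h1 : i.val ≠ t := fun h => hiX (Fin.ext h)
    have h2 : i.val ≠ t + 1 := fun h => hiY (Fin.ext h)
    have h3 : Equiv.swap (t + 1) (t + 2) (i.val + 1) = i.val + 1 :=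
      Equiv.swap_apply_of_ne_of_ne (by omega) (by omega)
    simp [eps, h1, h2, h3]

/-! ### Auxiliary facts on `finsum` and multisets -/

lemma finsum_mem_neg {ι G : Type*} [AddCommGroup G] (s : Set ι) (f : ι → G) :
    ∑ᶠ i ∈ s, - f i = - ∑ᶠ i ∈ s, f i := by
  simp only [finsum_mem_def, finsum_neg_distrib]

lemma finsum_mem_sub_of_finite {ι G : Type*} [AddCommGroup G] {s : Set ι} {f g : ι → G}
    (hf : (s ∩ Function.support f).Finite) (hg : (s ∩ Function.support g).Finite) :
    ∑ᶠ i ∈ s, (f i - g i) = ∑ᶠ i ∈ s, f i - ∑ᶠ i ∈ s, g i := by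
  simp only [sub_eq_add_neg]
  rw [finsum_mem_add_distrib' hf, finsum_mem_neg]
  have : (Function.support fun i => - g i) = Function.support g := by
    ext i
    simp
  rwa [this]

lemma multiset_powerset_map {ι κ : Type*} (f : ι → κ) (s : Multiset ι) :
    (s.map f).powerset = s.powerset.map (Multiset.map f) := by
  induction s using Multiset.induction_on with
  | empty => simp
  | cons a s ih => simp [Multiset.powerset_cons, ih]

/-! ### Raising operators -/

/-- Exponent functions supported on `Ψ`. -/
def exponents (Ψ : Finset (ℕ × ℕ)) : Set (ℕ × ℕ → ℕ) := {α | ∀ p, p ∉ Ψ → α p = 0}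

/-- The weight `∑ α(i,j) (ε_i − ε_j)` of an exponent function. -/
def rootWt (Ψ : Finset (ℕ × ℕ)) (α : ℕ × ℕ → ℕ) : ℕ → ℤ :=
  fun x => ∑ p ∈ Ψ, (α p : ℤ) * (eps p.1 x - eps p.2 x)

/-- The expansion of `∏_{(i,j) ∈ Ψ} (1 − R_{ij})⁻¹ f` at `γ`. -/
def raise (Ψ : Finset (ℕ × ℕ)) (f : (ℕ → ℤ) → R) (γ : ℕ → ℤ) : R :=
  ∑ᶠ α ∈ exponents Ψ, f (γ + rootWt Ψ α)

lemma katalan_eq_raise (ℓ : ℕ) (Ψ : Finset (ℕ × ℕ)) (M : Multiset ℕ) (γ : ℕ → ℤ) :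
    katalan ℓ Ψ M γ = (M.powerset.map fun S =>
      (-1 : R) ^ Multiset.card S * raise Ψ (gg ℓ) (γ - (S.map eps).sum)).sum := by
  unfold katalan
  congr 2
  funext S
  congr 1
  set g : ({p // p ∈ Ψ} → ℕ) → (ℕ × ℕ → ℕ) := fun α p => if h : p ∈ Ψ then α ⟨p, h⟩ else 0 with hg
  have hinj : Function.Injective g := by
    intro α β h
    funext p
    have := congrFun h p.1
    simpa [hg, p.2] using this
  have hrange : exponents Ψ = Set.range g := by
    ext α
    constructor
    · intro h
      refine ⟨fun p => α p.1, ?_⟩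
      funext p
      by_cases hp : p ∈ Ψ
      · simp [hg, hp]
      · simp [hg, hp, h p hp]
    · rintro ⟨β, rfl⟩ p hp
      simp [hg, hp]
  rw [raise, hrange, finsum_mem_range hinj]
  refine finsum_congr fun α => ?_
  congr 1
  funext x
  have h1 : (S.map eps).sum x = (S.map fun z => eps z x).sum := by
    induction S using Multiset.induction_on with
    | empty => simp
    | cons a s ih => simp [ih]
  have h2 : rootWt Ψ (g α) x = ∑ p ∈ Ψ.attach, (α p : ℤ) * (eps p.1.1 x - eps p.1.2 x) := by
    rw [rootWt, ← Finset.sum_attach]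
    refine Finset.sum_congr rfl fun p _ => ?_
    simp [hg]
  rw [Pi.add_apply, Pi.sub_apply, h1, h2]
  ring

lemma rootWt_of_exponents_erase {Ψ : Finset (ℕ × ℕ)} {β : ℕ × ℕ} {α : ℕ × ℕ → ℕ}
    (hα : α ∈ exponents (Ψ.erase β)) : rootWt Ψ α = rootWt (Ψ.erase β) α := by
  funext x
  refine (Finset.sum_subset (Finset.erase_subset _ _) fun p _ hp => ?_).symm
  simp [hα p hp]

lemma rootWt_add_single {Ψ : Finset (ℕ × ℕ)} {β : ℕ × ℕ} (hβ : β ∈ Ψ) (α : ℕ × ℕ → ℕ) :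
    rootWt Ψ (α + Pi.single β 1) = eps β.1 - eps β.2 + rootWt Ψ α := by
  funext x
  simp only [rootWt, Pi.add_apply, Pi.sub_apply, Nat.cast_add, add_mul, Finset.sum_add_distrib]
  rw [add_comm]
  congr 1
  rw [Finset.sum_eq_single β]
  · simp
  · intro p _ hp
    simp [Pi.single_eq_of_ne hp]
  · exact fun h => absurd hβ h

/-- Root expansion for a single root of `Ψ`. -/
lemma raise_erase {Ψ : Finset (ℕ × ℕ)} {β : ℕ × ℕ} (hβ : β ∈ Ψ) {f : (ℕ → ℤ) → R} {γ : ℕ → ℤ}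
    (hfin : (exponents Ψ ∩ Function.support fun α => f (γ + rootWt Ψ α)).Finite) :
    raise Ψ f γ = raise (Ψ.erase β) f γ + raise Ψ f (γ + (eps β.1 - eps β.2)) := by
  have hinj : Function.Injective fun α : ℕ × ℕ → ℕ => α + Pi.single β 1 := add_left_injective _
  have hunion : exponents Ψ = exponents (Ψ.erase β) ∪
      (fun α : ℕ × ℕ → ℕ => α + Pi.single β 1) '' exponents Ψ := by
    ext α
    constructor
    · intro h
      by_cases h0 : α β = 0
      · left
        intro p hp
        by_cases hpβ : p = β
        · rw [hpβ, h0]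
        · exact h p fun hp' => hp (Finset.mem_erase.2 ⟨hpβ, hp'⟩)
      · right
        refine ⟨α - Pi.single β 1, fun p hp => by simp [h p hp], ?_⟩
        funext p
        by_cases hpβ : p = β
        · subst hpβ
          simp
          omega
        · simp [Pi.single_eq_of_ne hpβ]
    · rintro (h | ⟨α', h, rfl⟩)
      · exact fun p hp => h p fun hp' => hp (Finset.mem_of_mem_erase hp')
      · intro p hp
        have : p ≠ β := fun e => hp (e ▸ hβ)
        simp [h p hp, Pi.single_eq_of_ne this]
  have hdisj : Disjoint (exponents (Ψ.erase β))
      ((fun α : ℕ × ℕ → ℕ => α + Pi.single β 1) '' exponents Ψ) := by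
    rw [Set.disjoint_left]
    rintro _ h ⟨α', -, rfl⟩
    have := h β (Finset.notMem_erase _ _)
    simp at this
  unfold raise
  conv_lhs => rw [hunion]
  rw [finsum_mem_union' hdisj]
  · congr 1
    · exact finsum_mem_congr rfl fun α hα => by rw [rootWt_of_exponents_erase hα]
    · rw [finsum_mem_image hinj.injOn]
      exact finsum_mem_congr rfl fun α _ => by rw [rootWt_add_single hβ, add_assoc]
  · exact hfin.subset (Set.inter_subset_inter_left _ (by rw [hunion]; exact Set.subset_union_left))
  · refine hfin.subset (Set.inter_subset_inter_left _ ?_)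
    conv_rhs => rw [hunion]
    exact Set.subset_union_right

lemma sum_eps (s : Finset ℕ) (a : ℕ) : ∑ x ∈ s, eps a x = if a ∈ s then 1 else 0 := by
  simp [eps]

lemma sum_rootWt_Icc (ℓ j : ℕ) (Ψ : Finset (ℕ × ℕ)) (α : ℕ × ℕ → ℕ) :
    ∑ x ∈ Finset.Icc j ℓ, rootWt Ψ α x = ∑ p ∈ Ψ, (α p : ℤ) *
      ((if p.1 ∈ Finset.Icc j ℓ then 1 else 0) - if p.2 ∈ Finset.Icc j ℓ then 1 else 0) := by
  simp only [rootWt]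
  rw [Finset.sum_comm]
  refine Finset.sum_congr rfl fun p _ => ?_
  rw [← Finset.mul_sum, Finset.sum_sub_distrib, sum_eps, sum_eps]

lemma mem_DeltaPlus {ℓ i j : ℕ} : (i, j) ∈ DeltaPlus ℓ ↔ 1 ≤ i ∧ i < j ∧ j ≤ ℓ := by
  simp only [DeltaPlus, Finset.mem_filter, Finset.mem_product, Finset.mem_Icc]
  omega

lemma sum_rootWt_Icc_le {ℓ j : ℕ} {Ψ : Finset (ℕ × ℕ)} (hΨ : Ψ ⊆ DeltaPlus ℓ)
    (α : ℕ × ℕ → ℕ) {q : ℕ × ℕ} (hq : q ∈ Ψ) (hqj : q.2 = j) :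
    ∑ x ∈ Finset.Icc j ℓ, rootWt Ψ α x ≤ - (α q : ℤ) := by
  rw [sum_rootWt_Icc, ← Finset.add_sum_erase _ _ hq]
  have h1 : ∀ p ∈ Ψ, (α p : ℤ) * ((if p.1 ∈ Finset.Icc j ℓ then 1 else 0) -
      if p.2 ∈ Finset.Icc j ℓ then 1 else 0) ≤ 0 := by
    intro p hp
    have hp' := mem_DeltaPlus.1 (hΨ hp)
    refine mul_nonpos_of_nonneg_of_nonpos (by positivity) ?_
    simp only [Finset.mem_Icc]
    split_ifs <;> omega
  have h2 : (α q : ℤ) * ((if q.1 ∈ Finset.Icc j ℓ then 1 else 0) -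
      if q.2 ∈ Finset.Icc j ℓ then 1 else 0) = - (α q : ℤ) := by
    have hq' := mem_DeltaPlus.1 (hΨ hq)
    rw [if_neg (by simp only [Finset.mem_Icc]; omega), if_pos (by simp only [Finset.mem_Icc]; omega)]
    ring
  have h3 := Finset.sum_nonpos fun p (hp : p ∈ Ψ.erase q) => h1 p (Finset.mem_of_mem_erase hp)
  rw [h2]
  linarith

lemma finite_support_gg {ℓ : ℕ} {Ψ : Finset (ℕ × ℕ)} (hΨ : Ψ ⊆ DeltaPlus ℓ) (γ : ℕ → ℤ) :
    (exponents Ψ ∩ Function.support fun α => gg ℓ (γ + rootWt Ψ α)).Finite := by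
  set B : ℕ × ℕ → ℕ := fun p => if p ∈ Ψ then (∑ x ∈ Finset.Icc p.2 ℓ, γ x).toNat else 0 with hB
  have hinj : Set.InjOn (fun (α : ℕ × ℕ → ℕ) (p : {p // p ∈ Ψ}) => α p.1)
      (exponents Ψ ∩ Function.support fun α => gg ℓ (γ + rootWt Ψ α)) := by
    intro α hα β hβ h
    funext p
    by_cases hp : p ∈ Ψ
    · exact congrFun h ⟨p, hp⟩
    · rw [hα.1 p hp, hβ.1 p hp]
  refine Set.Finite.of_finite_image ?_ hinj
  refine (Set.finite_Iic (fun p : {p // p ∈ Ψ} => B p.1)).subset ?_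
  rintro _ ⟨α, hα, rfl⟩ ⟨q, hq⟩
  by_contra hlt
  refine hα.2 (gg_eq_zero_of_tail_neg (j := q.2) ?_ ?_)
  · have := mem_DeltaPlus.1 (hΨ hq)
    omega
  · simp only [hB, hq, if_true] at hlt
    simp only [Pi.add_apply, Finset.sum_add_distrib]
    have := sum_rootWt_Icc_le hΨ α hq rfl
    omega

lemma raise_swap {Ψ : Finset (ℕ × ℕ)} (σ : Equiv.Perm ℕ) (hσ : ∀ x, σ (σ x) = x)
    (hΨ : ∀ i j, (i, j) ∈ Ψ → (σ i, σ j) ∈ Ψ) (f : (ℕ → ℤ) → R) (γ : ℕ → ℤ) :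
    raise Ψ f γ = ∑ᶠ α ∈ exponents Ψ, f (γ + rootWt Ψ α ∘ σ) := by
  have hΨ' : ∀ p : ℕ × ℕ, (σ p.1, σ p.2) ∈ Ψ → p ∈ Ψ := fun p hp => by
    simpa [hσ] using hΨ _ _ hp
  have hmem : Set.MapsTo (fun (α : ℕ × ℕ → ℕ) (p : ℕ × ℕ) => α (σ p.1, σ p.2))
      (exponents Ψ) (exponents Ψ) := fun α hα p hp => hα _ fun h => hp (hΨ' p h)
  have heps : ∀ i x, eps (σ i) x = eps i (σ x) := fun i x => by
    have : x = σ i ↔ σ x = i := ⟨fun h => by rw [h, hσ], fun h => by rw [← h, hσ]⟩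
    simp [eps, this]
  refine (finsum_mem_eq_of_bijOn _ ⟨hmem, ?_, ?_⟩ ?_).symm
  · intro α _ β _ h
    funext p
    simpa [hσ] using congrFun h (σ p.1, σ p.2)
  · intro α hα
    exact ⟨_, hmem hα, by simp [hσ]⟩
  · intro α _
    congr 2
    funext x
    simp only [rootWt, Function.comp_apply]
    refine Finset.sum_bij' (fun p _ => (σ p.1, σ p.2)) (fun p _ => (σ p.1, σ p.2))
      (fun p hp => hΨ _ _ hp) (fun p hp => hΨ _ _ hp) (by simp [hσ]) (by simp [hσ]) ?_
    intro p _
    simp only [heps, hσ]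

/-! ### Recurrences and vanishing for Katalan functions -/

lemma katalan_cons (ℓ : ℕ) (Ψ : Finset (ℕ × ℕ)) (m : ℕ) (M : Multiset ℕ) (γ : ℕ → ℤ) :
    katalan ℓ Ψ (m ::ₘ M) γ = katalan ℓ Ψ M γ - katalan ℓ Ψ M (γ - eps m) := by
  simp only [katalan_eq_raise, Multiset.powerset_cons, Multiset.map_add, Multiset.sum_add,
    Multiset.map_map, Function.comp_apply, Multiset.card_cons, Multiset.map_cons,
    Multiset.sum_cons, pow_succ, mul_neg, mul_one, neg_mul, sub_sub,
    sub_eq_add_neg (Multiset.sum _)]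
  rw [Multiset.sum_map_neg]

lemma katalan_erase {ℓ : ℕ} {Ψ : Finset (ℕ × ℕ)} (hΨ : Ψ ⊆ DeltaPlus ℓ) {i j : ℕ}
    (hij : (i, j) ∈ Ψ) (M : Multiset ℕ) (γ : ℕ → ℤ) :
    katalan ℓ Ψ M γ = katalan ℓ (Ψ.erase (i, j)) M γ + katalan ℓ Ψ M (γ + (eps i - eps j)) := by
  simp only [katalan_eq_raise]
  rw [← Multiset.sum_map_add]
  congr 1
  refine Multiset.map_congr rfl fun S _ => ?_
  rw [raise_erase hij (finite_support_gg hΨ _), mul_add, add_sub_right_comm]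

lemma katalan_eq_zero_of_last_neg {ℓ : ℕ} (hℓ : 1 ≤ ℓ) {Ψ : Finset (ℕ × ℕ)}
    (hΨ : Ψ ⊆ DeltaPlus ℓ) (M : Multiset ℕ) {γ : ℕ → ℤ} (hγ : γ ℓ < 0) :
    katalan ℓ Ψ M γ = 0 := by
  rw [katalan_eq_raise]
  refine Multiset.sum_eq_zero fun r hr => ?_
  obtain ⟨S, -, rfl⟩ := Multiset.mem_map.1 hr
  have h1 : 0 ≤ (S.map eps).sum ℓ := by
    clear hr
    induction S using Multiset.induction_on with
    | empty => simp
    | cons a s ih =>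
      have : 0 ≤ eps a ℓ := by unfold eps; split_ifs <;> norm_num
      simp only [Multiset.map_cons, Multiset.sum_cons, Pi.add_apply]
      linarith
  have h2 : raise Ψ (gg ℓ) (γ - (S.map eps).sum) = 0 := by
    unfold raise
    refine finsum_mem_eq_zero_of_forall_eq_zero fun α _ => ?_
    refine gg_eq_zero_of_tail_neg hℓ ?_
    have h3 : rootWt Ψ α ℓ ≤ 0 := by
      refine Finset.sum_nonpos fun p hp => ?_
      have hp' := mem_DeltaPlus.1 (hΨ hp)
      refine mul_nonpos_of_nonneg_of_nonpos (by positivity) ?_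
      simp only [eps]
      split_ifs <;> omega
    simp only [Finset.Icc_self, Finset.sum_singleton, Pi.add_apply, Pi.sub_apply]
    linarith
  rw [h2, mul_zero]

/-- A Katalan function with a wall in rows `y, y + 1` and a ceiling in columns `y, y + 1`
(equivalently, with `Ψ` stable under exchanging `y` and `y + 1`) vanishes when
`γ_y = γ_{y+1} − 1` and `y + 1` occurs in `M` once more than `y`. -/
lemma katalan_eq_zero_of_swap {ℓ y : ℕ} (hy : 1 ≤ y) (hyℓ : y + 1 ≤ ℓ) {Ψ : Finset (ℕ × ℕ)}
    (hΨ : Ψ ⊆ DeltaPlus ℓ) (hrow : ∀ j, (y, j) ∈ Ψ ↔ (y + 1, j) ∈ Ψ)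
    (hcol : ∀ i, (i, y) ∈ Ψ ↔ (i, y + 1) ∈ Ψ) {M : Multiset ℕ}
    (hM : M.count (y + 1) = M.count y + 1) {γ : ℕ → ℤ} (hγ : γ (y + 1) = γ y + 1) :
    katalan ℓ Ψ M γ = 0 := by
  obtain ⟨t, rfl⟩ : ∃ t, y = t + 1 := ⟨y - 1, by omega⟩
  set σ : Equiv.Perm ℕ := Equiv.swap (t + 1) (t + 2) with hσdef
  have hσ : ∀ x, σ (σ x) = x := fun x => Equiv.swap_apply_self _ _ _
  have hσΨ : ∀ i j, (i, j) ∈ Ψ → (σ i, σ j) ∈ Ψ := by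
    have hl : ∀ i j, (i, j) ∈ Ψ → (σ i, j) ∈ Ψ := by
      intro i j h
      by_cases h1 : i = t + 1
      · subst h1; rw [hσdef, Equiv.swap_apply_left]; exact (hrow j).1 h
      by_cases h2 : i = t + 2
      · subst h2; rw [hσdef, Equiv.swap_apply_right]; exact (hrow j).2 h
      rwa [hσdef, Equiv.swap_apply_of_ne_of_ne h1 h2]
    have hr : ∀ i j, (i, j) ∈ Ψ → (i, σ j) ∈ Ψ := by
      intro i j h
      by_cases h1 : j = t + 1
      · subst h1; rw [hσdef, Equiv.swap_apply_left]; exact (hcol i).1 h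
      by_cases h2 : j = t + 2
      · subst h2; rw [hσdef, Equiv.swap_apply_right]; exact (hcol i).2 h
      rwa [hσdef, Equiv.swap_apply_of_ne_of_ne h1 h2]
    exact fun i j h => hr _ _ (hl _ _ h)
  obtain ⟨N, rfl⟩ : ∃ N, M = (t + 2) ::ₘ N :=
    Multiset.exists_cons_of_mem (Multiset.count_pos.1 (by rw [hM]; omega))
  have hcount : N.count (t + 2) = N.count (t + 1) := by simpa using hM
  have hN : N.map σ = N := by
    ext x
    have hx : (N.map σ).count x = N.count (σ x) := by
      conv_lhs => rw [← hσ x]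
      exact Multiset.count_map_eq_count' _ _ σ.injective _
    rw [hx]
    by_cases h1 : x = t + 1
    · subst h1; rw [hσdef, Equiv.swap_apply_left, hcount]
    by_cases h2 : x = t + 2
    · subst h2; rw [hσdef, Equiv.swap_apply_right, hcount]
    rw [hσdef, Equiv.swap_apply_of_ne_of_ne h1 h2]
  set F : Multiset ℕ → R := fun S =>
    (-1 : R) ^ Multiset.card S * raise Ψ (ggLower ℓ t) (γ - (S.map eps).sum) with hF
  have hK : katalan ℓ Ψ ((t + 2) ::ₘ N) γ = (N.powerset.map F).sum := by
    rw [katalan_cons, katalan_eq_raise, katalan_eq_raise, ← Multiset.sum_map_sub]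
    congr 1
    refine Multiset.map_congr rfl fun S _ => ?_
    rw [← mul_sub]
    congr 1
    unfold raise ggLower
    rw [finsum_mem_sub_of_finite (finite_support_gg hΨ _)]
    · congr 1
      refine finsum_mem_congr rfl fun α _ => ?_
      congr 1
      abel
    · refine (finite_support_gg hΨ (γ - eps (t + 2) - (S.map eps).sum)).subset ?_
      refine Set.inter_subset_inter_right _ (le_of_eq ?_)
      congr 1
      funext α
      congr 1
      abel
  have hFσ : ∀ S, F (S.map σ) = - F S := by
    intro S
    have hwt : ((S.map σ).map eps).sum = (S.map eps).sum ∘ σ := by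
      induction S using Multiset.induction_on with
      | empty => rfl
      | cons a s ih =>
        simp only [Multiset.map_cons, Multiset.sum_cons, ih]
        funext x
        have : x = σ a ↔ σ x = a := ⟨fun h => by rw [h, hσ], fun h => by rw [← h, hσ]⟩
        simp [eps, this]
    have hγσ : γ = γ ∘ σ + (eps (t + 2) - eps (t + 1)) := by
      funext x
      simp only [Pi.add_apply, Pi.sub_apply, Function.comp_apply, eps]
      by_cases h1 : x = t + 1
      · subst h1
        rw [hσdef, Equiv.swap_apply_left, if_neg (by omega), if_pos rfl, hγ]
        ring
      by_cases h2 : x = t + 2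
      · subst h2
        rw [hσdef, Equiv.swap_apply_right, if_pos rfl, if_neg (by omega), hγ]
        ring
      rw [hσdef, Equiv.swap_apply_of_ne_of_ne h1 h2, if_neg h2, if_neg h1]
      ring
    simp only [hF, Multiset.card_map]
    rw [hwt, raise_swap σ hσ hσΨ, ← mul_neg]
    congr 1
    unfold raise
    rw [← finsum_mem_neg]
    refine finsum_mem_congr rfl fun α _ => ?_
    rw [← ggLower_swap (by omega)]
    congr 1
    conv_lhs => rw [hγσ]
    funext x
    simp only [Pi.add_apply, Pi.sub_apply, Function.comp_apply]
    ring
  have hneg : (N.powerset.map F).sum = - (N.powerset.map F).sum := by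
    conv_lhs => rw [← hN, multiset_powerset_map, Multiset.map_map]
    rw [← Multiset.sum_map_neg]
    congr 1
    exact Multiset.map_congr rfl fun S _ => hFσ S
  rw [hK]
  have h2 : (2 : ℚ) • (N.powerset.map F).sum = 0 := by
    rw [two_smul]
    exact eq_neg_iff_add_eq_zero.1 hneg
  rw [← one_smul ℚ (N.powerset.map F).sum, show (1 : ℚ) = 2⁻¹ * 2 by norm_num, mul_smul, h2,
    smul_zero]

/-! ### Combinatorics of `Δ^k(λ)` -/

lemma IsKBounded.antitone {k ℓ : ℕ} {lam : ℕ → ℤ} (h : IsKBounded k ℓ lam) {i j : ℕ}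
    (hi : 1 ≤ i) (hij : i ≤ j) (hj : j ≤ ℓ) : lam j ≤ lam i := by
  induction j, hij using Nat.le_induction with
  | base => exact le_rfl
  | succ n hn ih => exact (h.2.1 n (by omega) (by omega)).trans (ih (by omega))

lemma IsKBounded.le_k {k ℓ : ℕ} {lam : ℕ → ℤ} (h : IsKBounded k ℓ lam) {i : ℕ}
    (hi : 1 ≤ i) (hiℓ : i ≤ ℓ) : lam i ≤ k :=
  (h.antitone le_rfl hi hiℓ).trans h.1

/-- The first column of row `x` of `Δ^k(λ)`, if that row is nonempty. -/
def colStart (k : ℕ) (lam : ℕ → ℤ) (x : ℕ) : ℤ := k - lam x + x + 1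

lemma IsKBounded.lt_colStart {k ℓ : ℕ} {lam : ℕ → ℤ} (h : IsKBounded k ℓ lam) {i : ℕ}
    (hi : 1 ≤ i) (hiℓ : i ≤ ℓ) : (i : ℤ) < colStart k lam i := by
  have := h.le_k hi hiℓ
  unfold colStart
  omega

lemma IsKBounded.colStart_lt {k ℓ : ℕ} {lam : ℕ → ℤ} (h : IsKBounded k ℓ lam) {i j : ℕ}
    (hi : 1 ≤ i) (hij : i < j) (hj : j ≤ ℓ) : colStart k lam i < colStart k lam j := by
  have := h.antitone hi hij.le hj
  unfold colStart
  omega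

lemma mem_DeltaK {k ℓ : ℕ} {lam : ℕ → ℤ} (h : IsKBounded k ℓ lam) {i j : ℕ} :
    (i, j) ∈ DeltaK k ℓ lam ↔ 1 ≤ i ∧ i ≤ ℓ ∧ j ≤ ℓ ∧ colStart k lam i ≤ j := by
  simp only [DeltaK, Finset.mem_filter, mem_DeltaPlus]
  constructor
  · rintro ⟨⟨h1, h2, h3⟩, h4⟩
    refine ⟨h1, by omega, h3, ?_⟩
    unfold colStart
    omega
  · rintro ⟨h1, h2, h3, h4⟩
    have := h.lt_colStart h1 h2
    unfold colStart at *
    omega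

lemma DeltaK_subset (k ℓ : ℕ) (lam : ℕ → ℤ) : DeltaK k ℓ lam ⊆ DeltaPlus ℓ :=
  Finset.filter_subset _ _

lemma isRemovable_DeltaK_iff {k ℓ : ℕ} {lam : ℕ → ℤ} (h : IsKBounded k ℓ lam) {x j : ℕ} :
    IsRemovable ℓ (DeltaK k ℓ lam) (x, j) ↔ 1 ≤ x ∧ x ≤ ℓ ∧ j ≤ ℓ ∧ (j : ℤ) = colStart k lam x := by
  constructor
  · rintro ⟨hmem, -, hideal⟩
    have hmem' := (mem_DeltaK h).1 hmem
    obtain ⟨h1, h2, h3, h4⟩ := hmem'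
    refine ⟨h1, h2, h3, ?_⟩
    by_contra hne
    have hpos := h.lt_colStart h1 h2
    obtain ⟨s, hs⟩ : ∃ s : ℕ, (s : ℤ) = colStart k lam x :=
      ⟨(colStart k lam x).toNat, Int.toNat_of_nonneg (by omega)⟩
    have hsmem : (x, s) ∈ (DeltaK k ℓ lam).erase (x, j) := by
      rw [Finset.mem_erase]
      refine ⟨fun e => hne ?_, (mem_DeltaK h).2 ⟨h1, h2, by omega, hs.ge⟩⟩
      rw [← (Prod.mk.inj e).2]
      exact hs
    have := hideal x s x j hsmem (DeltaK_subset _ _ _ hmem) le_rfl (by omega)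
    exact Finset.notMem_erase _ _ this
  · rintro ⟨h1, h2, h3, h4⟩
    refine ⟨(mem_DeltaK h).2 ⟨h1, h2, h3, h4.ge⟩,
      (Finset.erase_subset _ _).trans (DeltaK_subset _ _ _), ?_⟩
    intro a b c d hab hcd hca hbd
    rw [Finset.mem_erase] at hab ⊢
    obtain ⟨hne, hab⟩ := hab
    obtain ⟨a1, a2, a3, a4⟩ := (mem_DeltaK h).1 hab
    have hcd' := mem_DeltaPlus.1 hcd
    have hmono : colStart k lam c ≤ colStart k lam a := by
      rcases hca.eq_or_lt with rfl | hlt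
      · exact le_rfl
      · exact (h.colStart_lt hcd'.1 hlt a2).le
    refine ⟨fun e => hne ?_, (mem_DeltaK h).2 ⟨hcd'.1, by omega, hcd'.2.2, by omega⟩⟩
    obtain ⟨rfl, rfl⟩ := Prod.ext_iff.1 e
    have hax : a = c := by
      by_contra hax
      have := h.colStart_lt h1 (show c < a by omega) a2
      simp only at *
      omega
    subst hax
    simp only at *
    rw [Prod.mk.injEq]
    exact ⟨rfl, by omega⟩

lemma downL_eq {k ℓ : ℕ} {lam : ℕ → ℤ} (h : IsKBounded k ℓ lam) {x : ℕ} (h1 : 1 ≤ x)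
    (h2 : x ≤ ℓ) (h3 : colStart k lam x ≤ ℓ) : (downL k ℓ lam x : ℤ) = colStart k lam x := by
  have hpos := h.lt_colStart h1 h2
  obtain ⟨s, hs⟩ : ∃ s : ℕ, (s : ℤ) = colStart k lam x :=
    ⟨(colStart k lam x).toNat, Int.toNat_of_nonneg (by omega)⟩
  have : ((DeltaK k ℓ lam).filter fun p => p.1 = x ∧ IsRemovable ℓ (DeltaK k ℓ lam) p)
      = {(x, s)} := by
    ext ⟨a, b⟩
    rw [Finset.mem_filter, Finset.mem_singleton, Prod.mk.injEq]
    constructor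
    · rintro ⟨-, rfl, hr⟩
      have : (b : ℤ) = colStart k lam a := ((isRemovable_DeltaK_iff h).1 hr).2.2.2
      exact ⟨rfl, by exact_mod_cast this.trans hs.symm⟩
    · rintro ⟨rfl, rfl⟩
      have := (isRemovable_DeltaK_iff (j := b) h).2 ⟨h1, h2, by omega, hs⟩
      exact ⟨this.1, rfl, this⟩
  rw [downL, down, this]
  simpa using hs

lemma of_downL_ne_zero {k ℓ : ℕ} {lam : ℕ → ℤ} (h : IsKBounded k ℓ lam) {x : ℕ}
    (hx : downL k ℓ lam x ≠ 0) : 1 ≤ x ∧ x ≤ ℓ ∧ colStart k lam x ≤ ℓ := by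
  by_contra hc
  refine hx ?_
  rw [downL, down, Finset.filter_false_of_mem]
  · simp
  · rintro ⟨a, b⟩ hab ⟨rfl, -⟩
    have := (mem_DeltaK h).1 hab
    simp only at *
    omega

lemma botL_le {k ℓ : ℕ} {lam : ℕ → ℤ} : botL k ℓ lam ≤ ℓ :=
  Finset.sup_le fun p hp => by
    have := mem_DeltaPlus.1 (DeltaK_subset _ _ _ hp)
    omega

lemma le_botL_iff {k ℓ : ℕ} {lam : ℕ → ℤ} (h : IsKBounded k ℓ lam) {x : ℕ} (h1 : 1 ≤ x)
    (h2 : x ≤ ℓ) : x ≤ botL k ℓ lam ↔ colStart k lam x ≤ ℓ := by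
  constructor
  · intro hx
    have hne : (DeltaK k ℓ lam).Nonempty := by
      by_contra hc
      rw [Finset.not_nonempty_iff_eq_empty] at hc
      simp [botL, botIdeal, hc] at hx
      omega
    obtain ⟨⟨a, b⟩, hp, hpe⟩ := Finset.exists_mem_eq_sup _ hne Prod.fst
    have hm := (mem_DeltaK h).1 hp
    rw [botL, botIdeal, hpe] at hx
    rcases hx.eq_or_lt with rfl | hlt
    · simp only at *
      omega
    · have := h.colStart_lt h1 hlt hm.2.1
      simp only at *
      omega
  · intro hx
    exact Finset.le_sup (f := Prod.fst) ((mem_DeltaK h).2 ⟨h1, h2, le_rfl, hx⟩)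

lemma count_Lmul_DeltaK {k ℓ : ℕ} {lam : ℕ → ℤ} (h : IsKBounded k ℓ lam) {j : ℕ} (hj : j ≤ ℓ) :
    (Lmul (DeltaK k ℓ lam)).count j =
      ((Finset.Icc 1 ℓ).filter fun x => colStart k lam x ≤ j).card := by
  rw [Lmul, Multiset.count_map, ← Finset.filter_val, Finset.card_val]
  refine Finset.card_bij (fun p _ => p.1) ?_ ?_ ?_
  · rintro ⟨a, b⟩ hp
    rw [Finset.mem_filter, mem_DeltaK h] at hp
    rw [Finset.mem_filter, Finset.mem_Icc]
    simp only at *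
    omega
  · rintro ⟨a, b⟩ hp ⟨c, d⟩ hq hac
    rw [Finset.mem_filter] at hp hq
    exact Prod.ext hac (hp.2.symm.trans hq.2)
  · intro x hx
    rw [Finset.mem_filter, Finset.mem_Icc] at hx
    refine ⟨(x, j), ?_, rfl⟩
    rw [Finset.mem_filter, mem_DeltaK h]
    exact ⟨⟨hx.1.1, hx.1.2, hj, hx.2⟩, rfl⟩

lemma count_map_downL {k ℓ : ℕ} {lam : ℕ → ℤ} (h : IsKBounded k ℓ lam) {z : ℕ} (hz : 1 ≤ z)
    {j : ℕ} (hj : j ≤ ℓ) :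
    ((Finset.Icc z (botL k ℓ lam)).val.map (downL k ℓ lam)).count j =
      ((Finset.Icc 1 ℓ).filter fun x => z ≤ x ∧ colStart k lam x = j).card := by
  rw [Multiset.count_map, ← Finset.filter_val, Finset.card_val]
  congr 1
  ext x
  simp only [Finset.mem_filter, Finset.mem_Icc]
  constructor
  · rintro ⟨⟨h1, h2⟩, h3⟩
    have hxℓ := h2.trans botL_le
    have hb := (le_botL_iff h (by omega) hxℓ).1 h2
    have := downL_eq h (by omega) hxℓ hb
    exact ⟨⟨by omega, hxℓ⟩, h1, by rw [h3, this]⟩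
  · rintro ⟨⟨h1, h2⟩, h3, h4⟩
    have := downL_eq h h1 h2 (by omega)
    exact ⟨⟨h3, (le_botL_iff h h1 h2).2 (by omega)⟩, by omega⟩

lemma count_Mz {k ℓ : ℕ} {lam : ℕ → ℤ} (h : IsKBounded k ℓ lam) {z : ℕ} (hz : 1 ≤ z)
    {j : ℕ} (hj : j ≤ ℓ) :
    (Mz k ℓ lam z).count j = ((Finset.Icc 1 ℓ).filter fun x =>
      colStart k lam x + (if z ≤ x then 1 else 0) ≤ j).card := by
  rw [Mz, Multiset.count_sub, count_Lmul_DeltaK h hj, count_map_downL h hz hj,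
    ← Finset.card_sdiff_of_subset]
  · congr 1
    ext x
    simp only [Finset.mem_sdiff, Finset.mem_filter, Finset.mem_Icc]
    split_ifs <;> omega
  · intro x
    simp only [Finset.mem_filter, Finset.mem_Icc]
    omega

lemma count_Mz_of_lt {k ℓ : ℕ} {lam : ℕ → ℤ} {z j : ℕ} (hj : ℓ < j) :
    (Mz k ℓ lam z).count j = 0 := by
  rw [Multiset.count_eq_zero]
  intro hmem
  have := Multiset.mem_of_le (tsub_le_self (α := Multiset ℕ)) hmem
  obtain ⟨⟨a, b⟩, hp, rfl⟩ := Multiset.mem_map.1 this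
  have := mem_DeltaPlus.1 (DeltaK_subset k ℓ lam hp)
  omega

/-- Lowering a part below row `z` whose row in `Δ^k(λ)` has at most one root keeps `M_z`. -/
lemma Mz_lower_of_le {k ℓ : ℕ} {lam : ℕ → ℤ} (h : IsKBounded k ℓ lam) {z y : ℕ} (hz : 1 ≤ z)
    (hzy : z ≤ y) (hμ : IsKBounded k ℓ (lam - eps y)) (hs : (ℓ : ℤ) ≤ colStart k lam y) :
    Mz k ℓ (lam - eps y) z = Mz k ℓ lam z := by
  ext j
  rcases lt_or_ge ℓ j with hj | hj
  · rw [count_Mz_of_lt hj, count_Mz_of_lt hj]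
  rw [count_Mz h hz hj, count_Mz hμ hz hj]
  congr 1
  refine Finset.filter_congr fun x _ => ?_
  simp only [colStart, Pi.sub_apply, eps] at *
  by_cases hx : x = y
  · subst hx
    simp only [if_true, hzy]
    omega
  · simp [hx]

lemma Mz_lower_of_lt {k ℓ : ℕ} {lam : ℕ → ℤ} (h : IsKBounded k ℓ lam) {z y w : ℕ} (hz : 1 ≤ z)
    (hzy : z ≤ y) (hyℓ : y ≤ ℓ) (hμ : IsKBounded k ℓ (lam - eps y)) (hwℓ : w ≤ ℓ)
    (hw : (w : ℤ) = colStart k lam y + 1) :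
    Mz k ℓ lam z = w ::ₘ Mz k ℓ (lam - eps y) z := by
  ext j
  rw [Multiset.count_cons]
  rcases lt_or_ge ℓ j with hj | hj
  · rw [count_Mz_of_lt hj, count_Mz_of_lt hj, if_neg (by omega)]
  rw [count_Mz h hz hj, count_Mz hμ hz hj]
  have hcol : ∀ x, colStart k (lam - eps y) x = colStart k lam x + if x = y then 1 else 0 := by
    intro x
    simp only [colStart, Pi.sub_apply, eps]
    ring
  by_cases hjw : j = w
  · rw [if_pos hjw, ← Finset.card_insert_of_notMem (a := y)]
    · congr 1
      ext x
      simp only [Finset.mem_insert, Finset.mem_filter, Finset.mem_Icc, hcol]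
      by_cases hx : x = y
      · subst hx
        simp only [hzy, if_true, true_or, iff_true]
        omega
      · simp [hx]
    · simp only [Finset.mem_filter, Finset.mem_Icc, hcol, if_pos hzy, if_true]
      omega
  · rw [if_neg hjw, add_zero]
    congr 1
    refine Finset.filter_congr fun x _ => ?_
    rw [hcol]
    by_cases hx : x = y
    · subst hx
      simp only [if_true, hzy]
      omega
    · simp [hx]

/-! ### Bounce paths -/

/-- `Bounce k ℓ lam z y` says that `y = down_λ^a(z)` for some `a ≥ 1`. -/
inductive Bounce (k ℓ : ℕ) (lam : ℕ → ℤ) (z : ℕ) : ℕ → Prop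
  | first (y : ℕ) (hy : (y : ℤ) = colStart k lam z) (hyℓ : y ≤ ℓ) : Bounce k ℓ lam z y
  | next (x y : ℕ) (hx : Bounce k ℓ lam z x) (hy : (y : ℤ) = colStart k lam x) (hyℓ : y ≤ ℓ) :
      Bounce k ℓ lam z y

lemma Bounce.lt_and_le {k ℓ : ℕ} {lam : ℕ → ℤ} (h : IsKBounded k ℓ lam) {z y : ℕ} (hz : 1 ≤ z)
    (hzℓ : z ≤ ℓ) (hy : Bounce k ℓ lam z y) : z < y ∧ y ≤ ℓ := by
  induction hy with
  | first y hy hyℓ =>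
    have := h.lt_colStart hz hzℓ
    omega
  | next x y hx hy hyℓ ih =>
    have := h.lt_colStart (show 1 ≤ x by omega) ih.2
    omega

/-- The predecessor of a point on the bounce path. -/
lemma Bounce.exists_pred {k ℓ : ℕ} {lam : ℕ → ℤ} (h : IsKBounded k ℓ lam) {z y : ℕ} (hz : 1 ≤ z)
    (hzℓ : z ≤ ℓ) (hy : Bounce k ℓ lam z y) :
    ∃ x, z ≤ x ∧ x ≤ ℓ ∧ (y : ℤ) = colStart k lam x := by
  cases hy with
  | first y hy hyℓ => exact ⟨z, le_rfl, hzℓ, hy⟩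
  | next x y hx hy hyℓ =>
    have := hx.lt_and_le h hz hzℓ
    exact ⟨x, this.1.le, this.2, hy⟩

lemma Bounce.congr {k ℓ : ℕ} {lam μ : ℕ → ℤ} (h : IsKBounded k ℓ lam) {z y : ℕ} (hz : 1 ≤ z)
    (hzℓ : z ≤ ℓ) (hy : Bounce k ℓ lam z y) (hμ : ∀ x < y, μ x = lam x) : Bounce k ℓ μ z y := by
  induction hy with
  | first y hy hyℓ =>
    have := h.lt_colStart hz hzℓ
    refine .first y ?_ hyℓ
    rw [hy, colStart, colStart, hμ z (by omega)]
  | next x y hx hy hyℓ ih =>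
    have hx' := hx.lt_and_le h hz hzℓ
    have := h.lt_colStart (show 1 ≤ x by omega) hx'.2
    refine .next x y (ih fun w hw => hμ w (by omega)) ?_ hyℓ
    rw [hy, colStart, colStart, hμ x (by omega)]

lemma Bounce.count_Mz_succ {k ℓ : ℕ} {lam : ℕ → ℤ} (h : IsKBounded k ℓ lam) {z y : ℕ}
    (hz : 1 ≤ z) (hzℓ : z ≤ ℓ) (hy : Bounce k ℓ lam z y) (hyℓ : y + 1 ≤ ℓ) :
    (Mz k ℓ lam z).count (y + 1) = (Mz k ℓ lam z).count y + 1 := by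
  obtain ⟨x, hzx, hxℓ, hyx⟩ := hy.exists_pred h hz hzℓ
  rw [count_Mz h hz hyℓ, count_Mz h hz (by omega), ← Finset.card_insert_of_notMem (a := x)]
  · congr 1
    ext w
    simp only [Finset.mem_insert, Finset.mem_filter, Finset.mem_Icc]
    by_cases hwx : w = x
    · subst hwx
      simp only [true_or, iff_true, if_pos hzx]
      push_cast
      omega
    simp only [hwx, false_or]
    push_cast
    constructor
    · rintro ⟨hw, hle⟩
      refine ⟨hw, ?_⟩
      rcases lt_or_gt_of_ne hwx with hlt | hgt
      · have := h.colStart_lt hw.1 hlt hxℓ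
        split_ifs at * <;> omega
      · have := h.colStart_lt (by omega) hgt hw.2
        rw [if_pos (by omega)] at hle
        omega
    · rintro ⟨hw, hle⟩
      exact ⟨hw, by omega⟩
  · simp only [Finset.mem_filter, if_pos hzx]
    omega

lemma bounce_iterate {k ℓ : ℕ} {lam : ℕ → ℤ} (h : IsKBounded k ℓ lam) {z : ℕ} (a : ℕ)
    (hne : (downL k ℓ lam)^[a + 1] z ≠ 0) : Bounce k ℓ lam z ((downL k ℓ lam)^[a + 1] z) := by
  have step : ∀ x, downL k ℓ lam x ≠ 0 →
      ((downL k ℓ lam x : ℕ) : ℤ) = colStart k lam x ∧ downL k ℓ lam x ≤ ℓ := by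
    intro x hx
    obtain ⟨h1, h2, h3⟩ := of_downL_ne_zero h hx
    have := downL_eq h h1 h2 h3
    exact ⟨this, by omega⟩
  induction a with
  | zero => exact .first _ (step z hne).1 (step z hne).2
  | succ a ih =>
    rw [Function.iterate_succ_apply'] at hne ⊢
    have hpre : (downL k ℓ lam)^[a + 1] z ≠ 0 := by
      have := of_downL_ne_zero h hne
      omega
    exact .next _ _ (ih hpre) (step _ hne).1 (step _ hne).2

/-! ### The mirror lemma -/

lemma katalan_eq_zero_of_ceiling {k ℓ : ℕ} {lam : ℕ → ℤ} (h : IsKBounded k ℓ lam) {z y : ℕ}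
    (hz : 1 ≤ z) (hzℓ : z ≤ ℓ) (hy : Bounce k ℓ lam z y) (hyℓ : y + 1 ≤ ℓ)
    {Φ : Finset (ℕ × ℕ)} (hΦ : Φ ⊆ DeltaPlus ℓ) (hrow : ∀ j, (y, j) ∈ Φ ↔ (y + 1, j) ∈ Φ)
    (hcol : ∀ i, 1 ≤ i → i < y → ((i, y) ∈ Φ ↔ (i, y + 1) ∈ Φ)) {γ : ℕ → ℤ}
    (hγy : γ (y + 1) = γ y + 1) : katalan ℓ Φ (Mz k ℓ lam z) γ = 0 := by
  have hlt := hy.lt_and_le h hz hzℓ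
  refine katalan_eq_zero_of_swap (by omega) hyℓ hΦ hrow (fun i => ?_)
    (hy.count_Mz_succ h hz hzℓ hyℓ) hγy
  by_cases hi : 1 ≤ i ∧ i < y
  · exact hcol i hi.1 hi.2
  · constructor
    · intro hm
      have := mem_DeltaPlus.1 (hΦ hm)
      omega
    · intro hm
      have hm' := mem_DeltaPlus.1 (hΦ hm)
      have hiy : i = y := by omega
      subst hiy
      have := mem_DeltaPlus.1 (hΦ ((hrow _).1 hm))
      omega

/-- Mirror lemma along the bounce path from a strict descent `λ_z > λ_{z+1}`. Here `Φ` agrees with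
`Δ^k(λ)` and `γ` with `λ` above row `y`. -/
lemma katalan_eq_zero_of_mirror {k ℓ : ℕ} {lam : ℕ → ℤ} (h : IsKBounded k ℓ lam) {z y : ℕ}
    (hz : 1 ≤ z) (hzℓ : z + 1 ≤ ℓ) (hstrict : lam (z + 1) < lam z) (hy : Bounce k ℓ lam z y)
    (hyℓ : y + 1 ≤ ℓ) {Φ : Finset (ℕ × ℕ)} (hΦ : Φ ⊆ DeltaPlus ℓ) {γ : ℕ → ℤ}
    (hrow : ∀ j, (y, j) ∈ Φ ↔ (y + 1, j) ∈ Φ)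
    (habove : ∀ i j, i < y → ((i, j) ∈ Φ ↔ (i, j) ∈ DeltaK k ℓ lam))
    (hγy : γ (y + 1) = γ y + 1) (hγ : ∀ i, i < y → γ i = lam i) :
    katalan ℓ Φ (Mz k ℓ lam z) γ = 0 := by
  induction hy generalizing Φ γ with
  | first y hy' hyℓ' =>
    refine katalan_eq_zero_of_ceiling h hz (by omega) (.first _ hy' hyℓ') hyℓ hΦ hrow
      (fun i hi1 hiy => ?_) hγy
    rw [habove i _ hiy, habove i _ hiy, mem_DeltaK h, mem_DeltaK h]
    have hcol : colStart k lam i ≤ (y : ℤ) ↔ colStart k lam i ≤ ((y + 1 : ℕ) : ℤ) := by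
      rcases le_or_gt i z with hiz | hiz
      · have : colStart k lam i ≤ colStart k lam z := by
          rcases hiz.eq_or_lt with rfl | hlt
          · exact le_rfl
          · exact (h.colStart_lt hi1 hlt (by omega)).le
        push_cast
        omega
      · have h1 : colStart k lam (z + 1) ≤ colStart k lam i := by
          rcases (show z + 1 ≤ i by omega).eq_or_lt with rfl | hlt
          · exact le_rfl
          · exact (h.colStart_lt (by omega) hlt (by omega)).le
        have h2 : colStart k lam z + 1 < colStart k lam (z + 1) := by
          unfold colStart
          push_cast
          omega
        push_cast
        omega
    omega
  | next x y hx hy' hyℓ' ih =>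
    have hxlt := hx.lt_and_le h hz (by omega)
    have hxy := h.lt_colStart (show 1 ≤ x by omega) hxlt.2
    have hstep := h.2.1 x (by omega) (by omega)
    have hlow : ∀ i, 1 ≤ i → i ≤ x → colStart k lam i ≤ y := by
      intro i hi1 hix
      rcases hix.eq_or_lt with rfl | hlt
      · exact hy'.ge
      · exact ((h.colStart_lt hi1 hlt (by omega)).le).trans hy'.ge
    have hhigh : ∀ i, x + 1 < i → i < y → colStart k lam (x + 1) < colStart k lam i :=
      fun i hi hiy => h.colStart_lt (by omega) hi (by omega)
    rcases hstep.eq_or_lt with heq | hlt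
    · have hxk : lam x < k := by
        have h1 := h.antitone (show 1 ≤ z + 1 by omega) (show z + 1 ≤ x by omega) hxlt.2
        have h2 := h.le_k hz (by omega)
        omega
      have hgap : x + 1 < y := by
        unfold colStart at hy'
        omega
      have hnext : colStart k lam (x + 1) = y + 1 := by
        rw [hy']
        unfold colStart
        push_cast
        omega
      have hβ : (x + 1, y) ∉ Φ := by
        rw [habove _ _ hgap, mem_DeltaK h]
        omega
      have hΘ : insert (x + 1, y) Φ ⊆ DeltaPlus ℓ :=
        Finset.insert_subset (mem_DeltaPlus.2 ⟨by omega, hgap, hyℓ'⟩) hΦ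
      have hexp := katalan_erase hΘ (Finset.mem_insert_self (x + 1, y) Φ) (Mz k ℓ lam z) γ
      rw [Finset.erase_insert hβ] at hexp
      have hceil : katalan ℓ (insert (x + 1, y) Φ) (Mz k ℓ lam z) γ = 0 := by
        refine katalan_eq_zero_of_ceiling h hz (by omega) (hx.next _ _ hy' hyℓ') hyℓ hΘ ?_ ?_ hγy
        · intro j
          have e1 : y ≠ x + 1 := by omega
          have e2 : y ≠ x := by omega
          simpa [Finset.mem_insert, e1, e2] using hrow j
        · intro i hi1 hiy
          simp only [Finset.mem_insert, Prod.mk.injEq, habove i _ hiy, mem_DeltaK h]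
          rcases le_or_gt i x with hix | hix
          · have := hlow i hi1 hix
            push_cast
            omega
          rcases (show x + 1 ≤ i by omega).eq_or_lt with rfl | hix'
          · push_cast
            simp only [and_true, true_and, true_or, true_iff]
            omega
          · have := hhigh i hix' hiy
            push_cast
            omega
      have hraise : katalan ℓ (insert (x + 1, y) Φ) (Mz k ℓ lam z)
          (γ + (eps (x + 1) - eps y)) = 0 := by
        refine ih (by omega) hΘ ?_ ?_ ?_ ?_
        · intro j
          simp only [Finset.mem_insert, Prod.mk.injEq, habove x _ (show x < y by omega),
            habove (x + 1) _ hgap, mem_DeltaK h,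
            true_and]
          omega
        · intro i j hi
          have e : i ≠ x + 1 := by omega
          simp only [Finset.mem_insert, Prod.mk.injEq, e, false_and, false_or]
          exact habove i j (by omega)
        · have e1 : x + 1 ≠ y := by omega
          have e2 : x ≠ y := by omega
          simp [eps, e1, e2, hγ x (by omega), hγ (x + 1) hgap, heq]
        · intro i hi
          have e1 : i ≠ y := by omega
          have e2 : i ≠ x + 1 := by omega
          simp [eps, e1, e2, hγ i (by omega)]
      rw [hceil, hraise, add_zero] at hexp
      exact hexp.symm
    · refine katalan_eq_zero_of_ceiling h hz (by omega) (hx.next _ _ hy' hyℓ') hyℓ hΦ hrow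
        (fun i hi1 hiy => ?_) hγy
      rw [habove i _ hiy, habove i _ hiy, mem_DeltaK h, mem_DeltaK h]
      have hcol : colStart k lam i ≤ (y : ℤ) ↔ colStart k lam i ≤ ((y + 1 : ℕ) : ℤ) := by
        rcases le_or_gt i x with hix | hix
        · have := hlow i hi1 hix
          push_cast
          omega
        have h2 : colStart k lam x + 1 < colStart k lam (x + 1) := by
          unfold colStart
          push_cast
          omega
        have h1 : colStart k lam (x + 1) ≤ colStart k lam i := by
          rcases (show x + 1 ≤ i by omega).eq_or_lt with rfl | hlt
          · exact le_rfl
          · exact (hhigh i hlt hiy).le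
        push_cast
        omega
      omega

/-! ### Sign-alternating expansions -/

/-- `F` expands alternating-negatively, relative to `λ`, in the `ĝ_μ^{(z)}` with `μ` agreeing with
`λ` in rows `[1, z]`. -/
def AltExpands (k ℓ z : ℕ) (lam : ℕ → ℤ) (F : R) : Prop :=
  ∃ b : (ℕ → ℤ) → ℤ,
    (Function.support b).Finite ∧
    (∀ μ, b μ ≠ 0 → IsKBounded k ℓ μ ∧ ∀ x ∈ Finset.Icc 1 z, μ x = lam x) ∧
    F = ∑ᶠ μ : ℕ → ℤ, b μ • wkschur k ℓ μ z ∧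
    ∀ μ, IsKBounded k ℓ μ → 0 ≤ (-1 : ℚ) ^ (psize ℓ lam - psize ℓ μ - 1) * (b μ : ℚ)

lemma altExpands_zero (k ℓ z : ℕ) (lam : ℕ → ℤ) : AltExpands k ℓ z lam 0 :=
  ⟨0, by simp, by simp, by simp, by simp⟩

lemma AltExpands.add {k ℓ z : ℕ} {lam : ℕ → ℤ} {F G : R} (hF : AltExpands k ℓ z lam F)
    (hG : AltExpands k ℓ z lam G) : AltExpands k ℓ z lam (F + G) := by
  obtain ⟨b, b1, b2, b3, b4⟩ := hF
  obtain ⟨c, c1, c2, c3, c4⟩ := hG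
  refine ⟨b + c, (b1.union c1).subset (Function.support_add b c), ?_, ?_, ?_⟩
  · intro μ hμ
    by_cases hb : b μ = 0
    · exact c2 μ fun hc => hμ (by simp [hb, hc])
    · exact b2 μ hb
  · rw [b3, c3, ← finsum_add_distrib]
    · simp only [Pi.add_apply, add_smul]
    · exact b1.subset fun μ hμ hb => hμ (by simp [hb])
    · exact c1.subset fun μ hμ hc => hμ (by simp [hc])
  · intro μ hμ
    have h1 := b4 μ hμ
    have h2 := c4 μ hμ
    rw [Pi.add_apply, Int.cast_add, mul_add]
    exact add_nonneg h1 h2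

lemma psize_sub_eps {ℓ y : ℕ} (hy : 1 ≤ y) (hyℓ : y ≤ ℓ) (lam : ℕ → ℤ) :
    psize ℓ (lam - eps y) = psize ℓ lam - 1 := by
  have hmem : y ∈ Finset.Icc 1 ℓ := Finset.mem_Icc.2 ⟨hy, hyℓ⟩
  simp only [psize, Pi.sub_apply, Finset.sum_sub_distrib, sum_eps, if_pos hmem]

lemma altExpands_wkschur {k ℓ z y : ℕ} {lam : ℕ → ℤ} (hzy : z < y) (hyℓ : y ≤ ℓ)
    (hμ : IsKBounded k ℓ (lam - eps y)) :
    AltExpands k ℓ z lam (wkschur k ℓ (lam - eps y) z) := by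
  refine ⟨Pi.single (lam - eps y) 1, ?_, ?_, ?_, ?_⟩
  · exact (Set.finite_singleton (lam - eps y)).subset Pi.support_single_subset
  · intro μ hne
    have : μ = lam - eps y := by
      by_contra hc
      exact hne (Pi.single_eq_of_ne hc _)
    subst this
    refine ⟨hμ, fun x hx => ?_⟩
    have : x ≠ y := by
      have := Finset.mem_Icc.1 hx
      omega
    simp [eps, this]
  · rw [finsum_eq_single _ (lam - eps y)]
    · simp
    · intro μ hne
      simp [Pi.single_eq_of_ne hne]
  · intro μ _
    by_cases hc : μ = lam - eps y
    · subst hc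
      rw [psize_sub_eps (by omega) hyℓ]
      simp
    · simp [Pi.single_eq_of_ne hc]

lemma AltExpands.neg_of_lower {k ℓ z y : ℕ} {lam : ℕ → ℤ} (hzy : z < y) (hyℓ : y ≤ ℓ) {F : R}
    (hF : AltExpands k ℓ z (lam - eps y) F) : AltExpands k ℓ z lam (-F) := by
  obtain ⟨b, b1, b2, b3, b4⟩ := hF
  refine ⟨-b, by rwa [Function.support_neg], ?_, ?_, ?_⟩
  · intro μ hμ
    obtain ⟨h1, h2⟩ := b2 μ fun hb => hμ (by simp [hb])
    refine ⟨h1, fun x hx => ?_⟩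
    have : x ≠ y := by
      have := Finset.mem_Icc.1 hx
      omega
    rw [h2 x hx]
    simp [eps, this]
  · rw [b3, ← finsum_neg_distrib]
    simp only [Pi.neg_apply, neg_smul]
  · intro μ hμ
    have h1 := b4 μ hμ
    rw [psize_sub_eps (by omega) hyℓ,
      show psize ℓ lam - 1 - psize ℓ μ - 1 = (psize ℓ lam - psize ℓ μ - 1) - 1 by ring,
      zpow_sub_one₀ (by norm_num)] at h1
    simp only [Pi.neg_apply, Int.cast_neg]
    norm_num at h1 ⊢
    linarith

/-! ### The expansion of the lowered Katalan functions -/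

lemma isKBounded_sub_eps {k ℓ y : ℕ} {lam : ℕ → ℤ} (h : IsKBounded k ℓ lam) (hy : 1 ≤ y)
    (hstep : y < ℓ → lam (y + 1) < lam y) (hlast : y = ℓ → 0 < lam ℓ) :
    IsKBounded k ℓ (lam - eps y) := by
  obtain ⟨h1, h2, h3⟩ := h
  have heps : ∀ x, eps y x = if x = y then 1 else 0 := fun x => rfl
  refine ⟨?_, fun i hi hiℓ => ?_, ?_⟩
  · rw [Pi.sub_apply, heps]
    split_ifs <;> omega
  · have := h2 i hi hiℓ
    rw [Pi.sub_apply, Pi.sub_apply, heps, heps]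
    split_ifs with e1 e2 e2
    · omega
    · omega
    · subst e2
      have := hstep hiℓ
      omega
    · omega
  · rw [Pi.sub_apply, heps]
    split_ifs with e
    · have := hlast e.symm
      omega
    · omega

lemma DeltaK_sub_eps {k ℓ y s : ℕ} {lam : ℕ → ℤ} (h : IsKBounded k ℓ lam)
    (hμ : IsKBounded k ℓ (lam - eps y)) (hs : (s : ℤ) = colStart k lam y) :
    DeltaK k ℓ (lam - eps y) = (DeltaK k ℓ lam).erase (y, s) := by
  ext ⟨i, j⟩
  rw [Finset.mem_erase, mem_DeltaK h, mem_DeltaK hμ, Ne, Prod.mk.injEq]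
  have hcol : colStart k (lam - eps y) i = colStart k lam i + if i = y then 1 else 0 := by
    simp only [colStart, Pi.sub_apply, eps]
    ring
  rw [hcol]
  by_cases hi : i = y
  · subst hi
    simp only [if_true, true_and]
    omega
  · simp [hi]

/-- The expansion when lowering `λ` at `y` leaves a partition, given the expansions further along
the bounce paths. -/
lemma altExpands_of_partition {k ℓ : ℕ} {lam : ℕ → ℤ} (h : IsKBounded k ℓ lam) {z y : ℕ}
    (hz : 1 ≤ z) (hzy : z < y) (hyℓ : y ≤ ℓ) (hμ : IsKBounded k ℓ (lam - eps y)) {s : ℕ}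
    (hs : (s : ℤ) = colStart k lam y)
    (ih_same : s ≤ ℓ →
      AltExpands k ℓ z lam (katalan ℓ (DeltaK k ℓ lam) (Mz k ℓ lam z) (lam - eps s)))
    (ih_lower : s + 1 ≤ ℓ → AltExpands k ℓ z (lam - eps y)
      (katalan ℓ (DeltaK k ℓ (lam - eps y)) (Mz k ℓ (lam - eps y) z)
        (lam - eps y - eps (s + 1)))) :
    AltExpands k ℓ z lam (katalan ℓ (DeltaK k ℓ lam) (Mz k ℓ lam z) (lam - eps y)) := by
  have hΔ := DeltaK_sub_eps h hμ hs
  have hw : AltExpands k ℓ z lam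
      (katalan ℓ (DeltaK k ℓ (lam - eps y)) (Mz k ℓ lam z) (lam - eps y)) := by
    rcases lt_or_ge s ℓ with hsℓ | hsℓ
    · rw [Mz_lower_of_lt h hz hzy.le hyℓ hμ (show s + 1 ≤ ℓ from hsℓ) (by push_cast; omega),
        katalan_cons, sub_eq_add_neg]
      exact (altExpands_wkschur hzy hyℓ hμ).add ((ih_lower hsℓ).neg_of_lower hzy hyℓ)
    · rw [← Mz_lower_of_le h hz hzy.le hμ (by omega)]
      exact altExpands_wkschur hzy hyℓ hμ
  rcases le_or_gt s ℓ with hsℓ | hsℓ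
  · have hmem : (y, s) ∈ DeltaK k ℓ lam := (mem_DeltaK h).2 ⟨by omega, hyℓ, hsℓ, hs.ge⟩
    rw [katalan_erase (DeltaK_subset _ _ _) hmem, ← hΔ,
      show lam - eps y + (eps y - eps s) = lam - eps s by abel]
    exact hw.add (ih_same hsℓ)
  · rwa [hΔ, Finset.erase_eq_of_notMem] at hw
    rw [mem_DeltaK h]
    omega

/-- The expansion when `λ_y = λ_{y+1}`: nothing is contributed at `y`. -/
lemma altExpands_of_eq {k ℓ : ℕ} {lam : ℕ → ℤ} (h : IsKBounded k ℓ lam) {z y : ℕ}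
    (hz : 1 ≤ z) (hzℓ : z + 1 ≤ ℓ) (hstrict : lam (z + 1) < lam z) (hy : Bounce k ℓ lam z y)
    (hyℓ : y + 1 ≤ ℓ) (heq : lam (y + 1) = lam y) {s : ℕ} (hs : (s : ℤ) = colStart k lam y)
    (ih_same : s ≤ ℓ →
      AltExpands k ℓ z lam (katalan ℓ (DeltaK k ℓ lam) (Mz k ℓ lam z) (lam - eps s))) :
    AltExpands k ℓ z lam (katalan ℓ (DeltaK k ℓ lam) (Mz k ℓ lam z) (lam - eps y)) := by
  have hlt := hy.lt_and_le h hz (by omega)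
  have hnext : colStart k lam (y + 1) = s + 1 := by
    rw [hs, colStart, colStart, heq]
    push_cast
    ring
  have hzero : katalan ℓ ((DeltaK k ℓ lam).erase (y, s)) (Mz k ℓ lam z) (lam - eps y) = 0 := by
    refine katalan_eq_zero_of_mirror h hz hzℓ hstrict hy hyℓ
      ((Finset.erase_subset _ _).trans (DeltaK_subset _ _ _)) ?_ ?_ ?_ ?_
    · intro j
      have e : y + 1 ≠ y := by omega
      simp only [Finset.mem_erase, mem_DeltaK h, ne_eq, Prod.mk.injEq, e, true_and, false_and,
        not_false_eq_true]
      omega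
    · intro i j hi
      have e : i ≠ y := by omega
      simp [Finset.mem_erase, e]
    · simp [eps, heq]
    · intro i hi
      have e : i ≠ y := by omega
      simp [eps, e]
  rcases le_or_gt s ℓ with hsℓ | hsℓ
  · have hmem : (y, s) ∈ DeltaK k ℓ lam := (mem_DeltaK h).2 ⟨by omega, hlt.2, hsℓ, hs.ge⟩
    rw [katalan_erase (DeltaK_subset _ _ _) hmem, hzero, zero_add,
      show lam - eps y + (eps y - eps s) = lam - eps s by abel]
    exact ih_same hsℓ
  · rw [Finset.erase_eq_of_notMem (by rw [mem_DeltaK h]; omega)] at hzero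
    rw [hzero]
    exact altExpands_zero _ _ _ _

lemma altExpands_of_bounce {k ℓ : ℕ} {z : ℕ} (hz : 1 ≤ z) (hzℓ : z + 1 ≤ ℓ) {lam : ℕ → ℤ}
    (h : IsKBounded k ℓ lam) (hstrict : lam (z + 1) < lam z) {y : ℕ}
    (hy : Bounce k ℓ lam z y) :
    AltExpands k ℓ z lam (katalan ℓ (DeltaK k ℓ lam) (Mz k ℓ lam z) (lam - eps y)) := by
  induction hn : ℓ - y using Nat.strong_induction_on generalizing lam y with
  | _ n ih =>
    subst hn
    have hlt := hy.lt_and_le h hz (by omega)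
    have hcol := h.lt_colStart (show 1 ≤ y by omega) hlt.2
    obtain ⟨s, hs⟩ : ∃ s : ℕ, (s : ℤ) = colStart k lam y :=
      ⟨(colStart k lam y).toNat, Int.toNat_of_nonneg (by omega)⟩
    have ih_same : s ≤ ℓ →
        AltExpands k ℓ z lam (katalan ℓ (DeltaK k ℓ lam) (Mz k ℓ lam z) (lam - eps s)) :=
      fun hsℓ => ih (ℓ - s) (by omega) h hstrict (.next y s hy hs hsℓ) rfl
    have partition_case : IsKBounded k ℓ (lam - eps y) →
        AltExpands k ℓ z lam (katalan ℓ (DeltaK k ℓ lam) (Mz k ℓ lam z) (lam - eps y)) := by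
      intro hμ
      refine altExpands_of_partition h hz hlt.1 hlt.2 hμ hs ih_same fun hsℓ => ?_
      refine ih (ℓ - (s + 1)) (by omega) hμ ?_ (.next y (s + 1) ?_ ?_ hsℓ) rfl
      · have e : z ≠ y := by omega
        have : 0 ≤ eps y (z + 1) := by
          unfold eps
          split_ifs <;> norm_num
        have : eps y z = 0 := by simp [eps, e]
        simp only [Pi.sub_apply]
        omega
      · refine hy.congr h hz (by omega) fun x hx => ?_
        simp [eps, hx.ne]
      · push_cast
        rw [hs]
        simp only [colStart, Pi.sub_apply, eps, if_true]
        ring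
    rcases hlt.2.eq_or_lt with rfl | hyℓ
    · by_cases hpos : 0 < lam y
      · exact partition_case (isKBounded_sub_eps h (by omega) (by omega) fun _ => hpos)
      · rw [katalan_eq_zero_of_last_neg (by omega) (DeltaK_subset _ _ _)]
        · exact altExpands_zero _ _ _ _
        · simp [eps]
          omega
    · rcases (h.2.1 y (by omega) hyℓ).eq_or_lt with heq | hdesc
      · exact altExpands_of_eq h hz hzℓ hstrict hy hyℓ heq hs ih_same
      · exact partition_case (isKBounded_sub_eps h (by omega) (fun _ => hdesc) (by omega))

lemma iterate_downL_ne_zero {k ℓ : ℕ} {lam : ℕ → ℤ} (h : IsKBounded k ℓ lam) {z a c : ℕ}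
    (hac : a ≤ c) (hc : (downL k ℓ lam)^[c] z ≠ 0) : (downL k ℓ lam)^[a] z ≠ 0 := by
  induction c, hac using Nat.le_induction with
  | base => exact hc
  | succ n hn ih =>
    refine ih ?_
    rw [Function.iterate_succ_apply'] at hc
    have := of_downL_ne_zero h hc
    omega

/-- the lowered Katalan functions along the bounce path from `z`
expand alternating-negatively in the `ĝ_μ^{(z)}`. -/
theorem statement10 (k ℓ : ℕ) (hℓ : 1 ≤ ℓ) (lam : ℕ → ℤ) (hlam : IsKBounded k ℓ lam)
    (z : ℕ) (hz : z ∈ Finset.Icc 1 (botL k ℓ lam - 1))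
    (hstrict : lam (z + 1) < lam z)
    (c' : ℕ) (hc1 : 1 ≤ c')
    (hc2 : (downL k ℓ lam)^[c'] z ∈ Finset.Icc (botL k ℓ lam + 1) ℓ)
    (hc3 : ∀ c, 1 ≤ c → c < c' →
      (downL k ℓ lam)^[c] z ∉ Finset.Icc (botL k ℓ lam + 1) ℓ) :
    ∀ a, 1 ≤ a → a ≤ c' →
      ∃ b : (ℕ → ℤ) → ℤ,
        (Function.support b).Finite ∧
        (∀ μ, b μ ≠ 0 → IsKBounded k ℓ μ ∧ ∀ x ∈ Finset.Icc 1 z, μ x = lam x) ∧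
        katalan ℓ (DeltaK k ℓ lam) (Mz k ℓ lam z) (lam - eps ((downL k ℓ lam)^[a] z)) =
          ∑ᶠ μ : ℕ → ℤ, b μ • wkschur k ℓ μ z ∧
        ∀ μ, IsKBounded k ℓ μ →
          0 ≤ (-1 : ℚ) ^ (psize ℓ lam - psize ℓ μ - 1) * (b μ : ℚ) := by
  intro a ha1 hac
  rw [Finset.mem_Icc] at hz hc2
  have hzℓ : z + 1 ≤ ℓ := by
    have := botL_le (k := k) (ℓ := ℓ) (lam := lam)
    omega
  obtain ⟨a, rfl⟩ : ∃ a', a = a' + 1 := ⟨a - 1, by omega⟩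
  have hne : (downL k ℓ lam)^[a + 1] z ≠ 0 :=
    iterate_downL_ne_zero hlam hac (by omega)
  exact altExpands_of_bounce hz.1 hzℓ hlam hstrict (bounce_iterate hlam a hne)

end
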